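/- Choose a representative [ρ_O] in each orbit O of the Q-action on Ĝ. Then the group algebra ℂH is Morita equivalent to the finite direct sum, over all Q-orbits O ⊆ Ĝ, of the twisted group algebras C(Stab([ρ_O]), c_{[ρ_O]}), where Stab([ρ_O]) := {q ∈ Q : q([ρ_O]) = [ρ_O]} and c_{[ρ_O]} is the restriction of c^{[ρ_O]} to Stab([ρ_O]) × Stab([ρ_O]). -/

import Mathlib

noncomputable section

/-- A representation is irreducible if the space is nonzero and has no nontrivial invariant
subspace. -/
def IsIrredRep {K V : Type} [Group K] [AddCommGroup V] [Module ℂ V]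
    (ρ : Representation ℂ K V) : Prop :=
  Nontrivial V ∧
    ∀ W : Submodule ℂ V, (∀ (k : K), ∀ v ∈ W, ρ k v ∈ W) → W = ⊥ ∨ W = ⊤

/-- Two representations are isomorphic if there is an intertwining linear equivalence. -/
def RepIso {K V W : Type} [Group K] [AddCommGroup V] [Module ℂ V]
    [AddCommGroup W] [Module ℂ W]
    (ρ : Representation ℂ K V) (σ : Representation ℂ K W) : Prop :=
  ∃ e : V ≃ₗ[ℂ] W, ∀ (k : K) (v : V), e (ρ k v) = σ k (e v)

/-- The representation `g ↦ ρ (h·g·h⁻¹)` of the (normal) kernel of `j`, for `h : H`. -/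
def conjRep {H Q : Type} [Group H] [Group Q] (j : H →* Q) {V : Type}
    [AddCommGroup V] [Module ℂ V] (ρ : Representation ℂ j.ker V) (h : H) :
    Representation ℂ j.ker V :=
  MonoidHom.comp ρ (MulAut.conjNormal h).toMonoidHom

/-- `τ(q₁,q₂) := s q₁ * s q₂ * (s (q₁ q₂))⁻¹`, an element of `G = ker j`. -/
def tau {H Q : Type} [Group H] [Group Q] (j : H →* Q) (s : Q → H)
    (hs : ∀ q, j (s q) = q) (q₁ q₂ : Q) : j.ker :=
  ⟨s q₁ * s q₂ * (s (q₁ * q₂))⁻¹, by simp [MonoidHom.mem_ker, hs, mul_assoc]⟩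

/-- Transport along an equality of indices, as a linear map. -/
def castHom {Ghat : Type} (V : Ghat → Type) [∀ r, AddCommGroup (V r)]
    [∀ r, Module ℂ (V r)] {a b : Ghat} (h : a = b) : V a →ₗ[ℂ] V b where
  toFun v := cast (congrArg V h) v
  map_add' := by subst h; intros; rfl
  map_smul' := by subst h; intros; rfl

/-- Two ℂ-algebras are Morita equivalent if their categories of left modules are
ℂ-linearly equivalent. -/
def MoritaEquiv (A B : Type) [Ring A] [Ring B] [Algebra ℂ A] [Algebra ℂ B] : Prop :=
  ∃ e : ModuleCat.{0} A ≌ ModuleCat.{0} B, ∃ _h : e.functor.Additive, e.functor.Linear ℂ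

/-- The underlying ℂ-vector space of the direct sum, over all `Q`-orbits `O ⊆ Ĝ` with chosen
representatives `[ρ_O] = rep r`, of the twisted group algebras `C(Stab([ρ_O]), c_{[ρ_O]})`:
it has basis the pairs `(r, q)` where `r` is an orbit representative and `q ∈ Stab(r)`. -/
structure SumAlg (Ghat Q : Type) (act : Q → Ghat → Ghat) (rep : Ghat → Ghat) where
  /-- the coefficient at the basis element `q ∈ Stab([ρ_O])` of the summand of the orbit of
  the representative `r` -/
  coef : Ghat → Q → ℂ
  supp_rep : ∀ r, r ∉ Set.range rep → ∀ q, coef r q = 0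
  supp_stab : ∀ r q, act q r ≠ r → coef r q = 0

section Corner

variable {A B : Type} [Ring A] [Ring B] [Algebra ℂ A] [Algebra ℂ B] (φ : B →ₙₐ[ℂ] A)

/-- The part `φ 1 • M` of an `A`-module `M` cut out by the idempotent `φ 1`. -/
def corner (M : Type) [AddCommGroup M] [Module A M] : AddSubgroup M where
  carrier := {m | φ 1 • m = m}
  add_mem' := by
    intro a b ha hb
    simp only [Set.mem_ofPred_eq] at *
    rw [smul_add, ha, hb]
  zero_mem' := by simp
  neg_mem' := by
    intro a ha
    simp only [Set.mem_ofPred_eq] at *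
    rw [smul_neg, ha]

variable {φ} in
theorem mem_corner {M : Type} [AddCommGroup M] [Module A M] {m : M} :
    m ∈ corner φ M ↔ φ 1 • m = m := Iff.rfl

theorem map_smul_mem_corner {M : Type} [AddCommGroup M] [Module A M] (b : B) (m : M) :
    (φ b • m : M) ∈ corner φ M := by
  rw [mem_corner (φ := φ), smul_smul, ← map_mul, one_mul]

instance (M : Type) [AddCommGroup M] [Module A M] : Module B (corner φ M) where
  smul b m := ⟨φ b • (m : M), map_smul_mem_corner φ b (m : M)⟩
  one_smul m := Subtype.ext m.2
  mul_smul a b m := Subtype.ext (by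
    change φ (a * b) • (m : M) = φ a • φ b • (m : M)
    rw [map_mul, mul_smul])
  smul_zero a := Subtype.ext (smul_zero (φ a))
  smul_add a x y := Subtype.ext (smul_add (φ a) (x : M) y)
  add_smul a b m := Subtype.ext (by
    change φ (a + b) • (m : M) = φ a • (m : M) + φ b • (m : M)
    rw [map_add, add_smul])
  zero_smul m := Subtype.ext (by
    change φ 0 • (m : M) = 0
    rw [map_zero, zero_smul])

theorem coe_corner_smul {M : Type} [AddCommGroup M] [Module A M] (b : B) (m : corner φ M) :
    ((b • m : corner φ M) : M) = φ b • (m : M) := rfl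

/-- The restriction of an `A`-linear map to the corners. -/
def cornerMap {M N : Type} [AddCommGroup M] [Module A M] [AddCommGroup N] [Module A N]
    (f : M →ₗ[A] N) : corner φ M →ₗ[B] corner φ N where
  toFun m := ⟨f m, by rw [mem_corner, ← map_smul, mem_corner.1 m.2]⟩
  map_add' x y := Subtype.ext (map_add f (x : M) y)
  map_smul' b x := Subtype.ext (map_smul f (φ b) (x : M))

open CategoryTheory

/-- The functor `M ↦ φ 1 • M` from `A`-modules to `B`-modules. -/
def cornerFunctor : ModuleCat.{0} A ⥤ ModuleCat.{0} B where
  obj M := ModuleCat.of B (corner φ M)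
  map f := ModuleCat.ofHom (cornerMap φ f.hom)

instance : (cornerFunctor φ).Additive where
  map_add := rfl

open scoped ModuleCat in
instance : (cornerFunctor φ).Linear ℂ where
  map_smul {M N} f r := by
    ext m
    apply Subtype.ext
    change algebraMap ℂ A r • f.hom (m : corner φ M).1 =
      φ (algebraMap ℂ B r) • f.hom (m : corner φ M).1
    rw [Algebra.algebraMap_eq_smul_one, Algebra.algebraMap_eq_smul_one, map_smul, smul_assoc,
      smul_assoc, one_smul, ← map_smul f.hom, mem_corner.1 (m : corner φ M).2]

/-- Left multiplication `x ↦ x * a` on the left corner of `A`. -/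
def cornerMulRight (a : A) : corner φ A →ₗ[B] corner φ A :=
  cornerMap φ (LinearMap.toSpanSingleton A A a)

theorem coe_cornerMulRight (a : A) (x : corner φ A) :
    (cornerMulRight φ a x : A) = x * a := rfl

/-- The module of `B`-linear maps from `φ 1 * A` to `N`, on which `A` acts through right
multiplication on `φ 1 * A`. -/
abbrev Coinduced (N : Type) [AddCommGroup N] [Module B N] : Type := corner φ A →ₗ[B] N

instance (N : Type) [AddCommGroup N] [Module B N] : Module A (Coinduced φ N) where
  smul a f := LinearMap.comp f (cornerMulRight φ a)
  one_smul f := LinearMap.ext fun x => congrArg f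
    (Subtype.ext (mul_one (x : A)))
  mul_smul a b f := LinearMap.ext fun x => congrArg f
    (Subtype.ext (mul_assoc (x : A) a b).symm)
  smul_zero a := rfl
  smul_add a f g := rfl
  add_smul a b f := LinearMap.ext fun x => by
    refine Eq.trans ?_ (map_add f (cornerMulRight φ a x) (cornerMulRight φ b x))
    exact congrArg f (Subtype.ext (mul_add (x : A) a b))
  zero_smul f := LinearMap.ext fun x => by
    refine Eq.trans ?_ (map_zero f)
    exact congrArg f (Subtype.ext (mul_zero (x : A)))

/-- An injective non-unital homomorphism `B → A` identifying `B` with the corner `e A e` of the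
idempotent `e = φ 1`, which is full: `A e A = A`. -/
structure IsFullCorner : Prop where
  injective : Function.Injective φ
  exists_eq : ∀ a, ∃ b, φ b = φ 1 * a * φ 1
  full : (1 : A) ∈ Submodule.span ℂ {x | ∃ a b, x = a * φ 1 * b}

namespace IsFullCorner

variable {φ} (h : IsFullCorner φ)
include h

theorem exists_sum : ∃ (n : ℕ) (a b : Fin n → A), ∑ i, a i * φ 1 * b i = 1 := by
  obtain ⟨n, f, g, hfg⟩ := Submodule.mem_span_set'.1 h.full
  choose a b hab using fun i => (g i).2
  refine ⟨n, fun i => f i • a i, b, ?_⟩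
  rw [← hfg]
  exact Finset.sum_congr rfl fun i _ => by rw [hab, smul_mul_assoc, smul_mul_assoc]

theorem faithful : (cornerFunctor φ).Faithful where
  map_injective {M N} f g hfg := by
    obtain ⟨n, a, b, hab⟩ := h.exists_sum
    ext m
    have key (x : M) : f.hom (φ 1 • x) = g.hom (φ 1 • x) :=
      congrArg Subtype.val (congrArg (fun t : (cornerFunctor φ).obj M ⟶ (cornerFunctor φ).obj N =>
        (t.hom : corner φ M →ₗ[B] corner φ N) ⟨φ 1 • x, map_smul_mem_corner φ 1 x⟩) hfg)
    rw [← one_smul A m, ← hab]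
    simp only [Finset.sum_smul, mul_smul, map_sum]
    refine Finset.sum_congr rfl fun i _ => ?_
    rw [map_smul f.hom (a i), key, ← map_smul g.hom (a i)]

theorem exists_cornerMap_eq {M N : Type} [AddCommGroup M] [Module A M] [AddCommGroup N]
    [Module A N] (g : corner φ M →ₗ[B] corner φ N) : ∃ f : M →ₗ[A] N, cornerMap φ f = g := by
  obtain ⟨n, a, b, hab⟩ := h.exists_sum
  let c (m : M) : corner φ M := ⟨φ 1 • m, map_smul_mem_corner φ 1 m⟩
  have c_add (x y : M) : c (x + y) = c x + c y := Subtype.ext (smul_add _ _ _)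
  have c_sum {n : ℕ} (x : Fin n → M) : c (∑ i, x i) = ∑ i, c (x i) :=
    map_sum (AddMonoidHom.mk' c c_add) x _
  have key (x : A) (m : M) : (g (c (x • φ 1 • m)) : N) = φ 1 • x • (g (c m) : N) := by
    obtain ⟨y, hy⟩ := h.exists_eq x
    have h1 : c (x • φ 1 • m) = y • c m := Subtype.ext (by
      change φ 1 • x • φ 1 • m = φ y • φ 1 • m
      rw [hy, smul_smul, smul_smul, smul_smul, mul_assoc _ (φ 1), ← map_mul, mul_one, mul_assoc])
    rw [h1, map_smul, coe_corner_smul, hy, mul_smul, mul_smul, mem_corner.1 (g (c m)).2]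
  let F (m : M) : N := ∑ i, a i • (g (c (b i • m)) : N)
  have F_add (x y : M) : F (x + y) = F x + F y := by
    simp only [F, smul_add, c_add, map_add, AddSubgroup.coe_add, Finset.sum_add_distrib]
  have hF (m : M) : ∀ x : A, (∑ i, a i • φ 1 • (b i * x) • (g (c m) : N)) = x • (g (c m) : N) := by
    intro x
    conv_rhs => rw [← one_mul x, ← hab, Finset.sum_mul, Finset.sum_smul]
    exact Finset.sum_congr rfl fun i _ => by simp only [mul_smul]
  have F_smul (x : A) (m : M) : F (x • m) = x • F m := by
    have hm : m = ∑ k, a k • φ 1 • (b k • m) := by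
      conv_lhs => rw [← one_smul A m, ← hab, Finset.sum_smul]
      exact Finset.sum_congr rfl fun i _ => by simp only [mul_smul]
    calc F (x • m) = ∑ i, a i • (g (c (b i • x • ∑ k, a k • φ 1 • (b k • m))) : N) := by
            rw [← hm]
      _ = ∑ i, ∑ k, a i • φ 1 • (b i * (x * a k)) • (g (c (b k • m)) : N) := by
            refine Finset.sum_congr rfl fun i _ => ?_
            rw [Finset.smul_sum, Finset.smul_sum, c_sum, map_sum, AddSubgroup.val_finsetSum,
              Finset.smul_sum]
            refine Finset.sum_congr rfl fun k _ => ?_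
            rw [← key, mul_smul, mul_smul]
      _ = x • F m := by
            rw [Finset.sum_comm, Finset.smul_sum]
            refine Finset.sum_congr rfl fun k _ => ?_
            rw [hF, mul_smul]
  refine ⟨⟨⟨F, F_add⟩, F_smul⟩, LinearMap.ext fun m => Subtype.ext ?_⟩
  change F m = _
  have hc : c m = m := Subtype.ext (mem_corner.1 m.2)
  have := hF m 1
  rw [one_smul, hc] at this
  rw [← this]
  refine Finset.sum_congr rfl fun i _ => ?_
  have := key (b i) m
  rw [mem_corner.1 m.2, hc] at this
  rw [this, mul_one]

theorem full_functor : (cornerFunctor φ).Full where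
  map_surjective {M N} g := by
    obtain ⟨f, hf⟩ := h.exists_cornerMap_eq (M := M) (N := N) g.hom
    exact ⟨ModuleCat.ofHom f, ModuleCat.hom_ext hf⟩

/-- The corner of the coinduced module is the module one started with. -/
theorem exists_linearEquiv_corner_coinduced (N : Type) [AddCommGroup N] [Module B N] :
    Nonempty (corner φ (Coinduced φ N) ≃ₗ[B] N) := by
  let emb (b : B) : corner φ A := ⟨φ b, by rw [mem_corner, smul_eq_mul, ← map_mul, one_mul]⟩
  have emb_smul (b x : B) : emb (b * x) = b • emb x := Subtype.ext (map_mul φ b x)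
  let ev : corner φ (Coinduced φ N) →ₗ[B] N :=
    { toFun := fun f => f.1 (emb 1)
      map_add' := fun f g => rfl
      map_smul' := fun b f => by
        change f.1 (cornerMulRight φ (φ b) (emb 1)) =
          b • f.1 (emb 1)
        rw [← map_smul]
        congr 1
        apply Subtype.ext
        rw [coe_cornerMulRight, coe_corner_smul, smul_eq_mul]
        change φ 1 * φ b = φ b * φ 1
        rw [← map_mul, ← map_mul, one_mul, mul_one] }
  have hmem (f : corner φ (Coinduced φ N)) (x : corner φ A) :
      f.1 (cornerMulRight φ (φ 1) x) = f.1 x :=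
    LinearMap.congr_fun (mem_corner.1 f.2 : (φ 1 • f.1 : Coinduced φ N) = f.1) x
  have hx (x : corner φ A) : ∃ y : B, cornerMulRight φ (φ 1) x = y • emb 1 := by
    obtain ⟨y, hy⟩ := h.exists_eq x
    refine ⟨y, Subtype.ext ?_⟩
    rw [coe_cornerMulRight, coe_corner_smul, smul_eq_mul]
    change (x : A) * φ 1 = φ y * φ 1
    have hx' : φ 1 * (x : A) = x := mem_corner.1 x.2
    rw [hy, hx', mul_assoc, ← map_mul, one_mul]
  refine ⟨LinearEquiv.ofBijective ev ⟨?_, ?_⟩⟩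
  · rw [injective_iff_map_eq_zero]
    intro f hf
    refine Subtype.ext (LinearMap.ext fun x => ?_)
    obtain ⟨y, hy⟩ := hx x
    change f.1 x = 0
    rw [← hmem f x, hy, map_smul]
    exact (congrArg (y • ·) hf).trans (smul_zero y)
  · intro n
    choose y hy using hx
    have uniq {b c : B} (hbc : b • emb 1 = c • emb 1) : b = c := by
      rw [← emb_smul, ← emb_smul, mul_one, mul_one] at hbc
      exact h.injective (congrArg Subtype.val hbc)
    let f : corner φ A →ₗ[B] N :=
      { toFun := fun x => y x • n
        map_add' := fun u v => by
          rw [← add_smul]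
          congr 1
          apply uniq
          rw [← hy, add_smul, ← hy, ← hy, map_add]
        map_smul' := fun b u => by
          rw [RingHom.id_apply, smul_smul]
          congr 1
          apply uniq
          rw [← hy, mul_smul, ← hy, map_smul] }
    have hf : f ∘ₗ cornerMulRight φ (φ 1) = f := LinearMap.ext fun x => by
      change y _ • n = y _ • n
      congr 1
      apply uniq
      rw [← hy, ← hy]
      apply Subtype.ext
      simp only [coe_cornerMulRight, mul_assoc, ← map_mul, one_mul]
    refine ⟨⟨f, hf⟩, ?_⟩
    change y (emb 1) • n = n
    conv_rhs => rw [← one_smul B n]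
    congr 1
    apply uniq
    rw [← hy, one_smul]
    apply Subtype.ext
    rw [coe_cornerMulRight]
    change φ 1 * φ 1 = φ 1
    rw [← map_mul, one_mul]

theorem essSurj : (cornerFunctor φ).EssSurj where
  mem_essImage N := by
    obtain ⟨e⟩ := h.exists_linearEquiv_corner_coinduced N
    exact ⟨ModuleCat.of A (Coinduced φ N), ⟨LinearEquiv.toModuleIso e⟩⟩

theorem moritaEquiv : MoritaEquiv A B := by
  have := h.faithful
  have := h.full_functor
  have := h.essSurj
  have : (cornerFunctor φ).IsEquivalence := {}
  exact ⟨(cornerFunctor φ).asEquivalence, inferInstanceAs (cornerFunctor φ).Additive,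
    inferInstanceAs ((cornerFunctor φ).Linear ℂ)⟩

end IsFullCorner

end Corner

section Wedderburn

open scoped MonoidAlgebra

theorem isIrredRep_iff_isSimpleModule {K V : Type} [Group K] [AddCommGroup V] [Module ℂ V]
    (ρ : Representation ℂ K V) : IsIrredRep ρ ↔ IsSimpleModule ℂ[K] ρ.asModule := by
  rw [← Representation.irreducible_iff_isSimpleModule_asModule]
  constructor
  · rintro ⟨hn, hW⟩
    obtain ⟨v, hv⟩ := exists_ne (0 : V)
    refine { exists_pair_ne := ⟨⊥, ⊤, fun h => hv ?_⟩, eq_bot_or_eq_top := fun W => ?_ }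
    · have : v ∈ (⊥ : Subrepresentation ρ) := h ▸ (trivial : v ∈ (⊤ : Submodule ℂ V))
      exact this
    · refine (hW W.toSubmodule fun k v hv => W.apply_mem_toSubmodule k hv).imp ?_ ?_ <;>
      exact fun h => Subrepresentation.toSubmodule_injective h
  · intro h
    refine ⟨?_, fun W hW => ?_⟩
    · by_contra hn
      rw [not_nontrivial_iff_subsingleton] at hn
      apply bot_ne_top (α := Subrepresentation ρ)
      apply Subrepresentation.toSubmodule_injective
      exact Subsingleton.elim _ _
    · refine (eq_bot_or_eq_top (⟨W, fun k v hv => hW k v hv⟩ : Subrepresentation ρ)).imp ?_ ?_ <;>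
      exact fun h => congrArg Subrepresentation.toSubmodule h

/-- Intertwining maps as linear maps over the group algebra. -/
theorem repIso_of_linearEquiv {K V W : Type} [Group K] [AddCommGroup V] [Module ℂ V]
    [AddCommGroup W] [Module ℂ W] {ρ : Representation ℂ K V} {σ : Representation ℂ K W}
    (e : ρ.asModule ≃ₗ[ℂ[K]] σ.asModule) : RepIso ρ σ := by
  refine ⟨e.restrictScalars ℂ, fun k v => ?_⟩
  have := e.map_smul (MonoidAlgebra.single k 1) (ρ.asModuleEquiv.symm v)
  rw [Representation.single_smul, Representation.single_smul, one_smul, one_smul] at this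
  exact this

variable {K : Type} [Group K] {I : Type} (V : I → Type)
  [∀ r, AddCommGroup (V r)] [∀ r, Module ℂ (V r)] (ρ : ∀ r, Representation ℂ K (V r))

/-- The action of the group algebra on a family of representations. -/
def actionHom : ℂ[K] →ₐ[ℂ] (∀ r, Module.End ℂ (V r)) :=
  AlgHom.pi fun r => (ρ r).asAlgebraHom

variable {V ρ}

theorem exists_addEquiv_of_isSimpleModule [Finite K]
    (hcomplete : ∀ (W : Type) [AddCommGroup W] [Module ℂ W] [FiniteDimensional ℂ W]
      (σ : Representation ℂ K W), IsIrredRep σ → ∃ r, RepIso σ (ρ r))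
    (M : Type) [AddCommGroup M] [Module ℂ[K] M] [IsSimpleModule ℂ[K] M] :
    ∃ (r : I) (e : M ≃+ V r), ∀ (a : ℂ[K]) (m : M), e (a • m) = (ρ r).asAlgebraHom a (e m) := by
  let : Module ℂ M := Module.restrictScalars ℂ ℂ[K] M
  have : IsScalarTower ℂ ℂ[K] M := IsScalarTower.restrictScalars ℂ ℂ[K] M
  have : Module.Finite ℂ ℂ[K] := inferInstance
  have : FiniteDimensional ℂ M := Module.Finite.trans ℂ[K] M
  let σ : Representation ℂ K M := Representation.ofModule' M
  have hσ (a : ℂ[K]) (m : M) : σ.asAlgebraHom a m = a • m := by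
    induction a using MonoidAlgebra.induction_linear with
    | zero => simp
    | add x y hx hy => simp [hx, hy, add_smul]
    | single g c =>
      have : MonoidAlgebra.single g c = c • MonoidAlgebra.of ℂ K g := by simp
      rw [Representation.asAlgebraHom_single, this, smul_assoc]
      rfl
  have hirr : IsIrredRep σ := by
    refine ⟨IsSimpleModule.nontrivial ℂ[K] M, fun W hW => ?_⟩
    let W' : Submodule ℂ[K] M :=
      { W with
        smul_mem' := fun a m hm => by
          rw [← hσ]
          induction a using MonoidAlgebra.induction_linear with
          | zero => simp
          | add x y hx hy => simpa using W.add_mem hx hy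
          | single g c => simpa using W.smul_mem c (hW g m hm) }
    refine (eq_bot_or_eq_top W').imp ?_ ?_ <;>
    exact fun h => Submodule.ext fun x => (SetLike.ext_iff.1 h x :)
  obtain ⟨r, e, he⟩ := hcomplete M σ hirr
  refine ⟨r, e.toAddEquiv, fun a m => ?_⟩
  change e (a • m) = (ρ r).asAlgebraHom a (e m)
  rw [← hσ]
  induction a using MonoidAlgebra.induction_linear with
  | zero => simp
  | add x y hx hy => simp [hx, hy]
  | single g c => simp [he]

theorem actionHom_injective [Finite K]
    (hcomplete : ∀ (W : Type) [AddCommGroup W] [Module ℂ W] [FiniteDimensional ℂ W]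
      (σ : Representation ℂ K W), IsIrredRep σ → ∃ r, RepIso σ (ρ r)) :
    Function.Injective (actionHom V ρ) := by
  rw [injective_iff_map_eq_zero]
  intro a ha
  have key : ∀ x : ℂ[K], x ∈ (⊤ : Submodule ℂ[K] ℂ[K]) → a * x = 0 := by
    rw [← IsSemisimpleModule.sSup_simples_eq_top, sSup_eq_iSup']
    intro x hx
    induction hx using Submodule.iSup_induction' with
    | zero => simp
    | add x y _ _ hx hy => rw [mul_add, hx, hy, add_zero]
    | mem S x hx =>
      have : IsSimpleModule ℂ[K] S.1 := S.2
      obtain ⟨r, e, he⟩ := exists_addEquiv_of_isSimpleModule hcomplete S.1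
      have h0 : (ρ r).asAlgebraHom a = 0 := congrFun ha r
      have := he a ⟨x, hx⟩
      rw [h0, LinearMap.zero_apply, AddEquiv.map_eq_zero_iff] at this
      exact congrArg Subtype.val this
  simpa using key 1 trivial

theorem actionHom_surjective [Finite K] [Fintype I] [∀ r, FiniteDimensional ℂ (V r)]
    (hirr : ∀ r, IsIrredRep (ρ r)) (hdist : ∀ r r', RepIso (ρ r) (ρ r') → r = r') :
    Function.Surjective (actionHom V ρ) := by
  classical
  intro B
  have hsimple (r) : IsSimpleModule ℂ[K] (ρ r).asModule :=
    (isIrredRep_iff_isSimpleModule _).1 (hirr r)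
  let M := ∀ r, (ρ r).asModule
  have schur (φ : Module.End ℂ[K] M) (r : I) : ∃ c : ℂ, ∀ m : M, φ m r = c • m r := by
    let f (r') : (ρ r').asModule →ₗ[ℂ[K]] (ρ r).asModule :=
      LinearMap.proj r ∘ₗ φ ∘ₗ LinearMap.single ℂ[K] (fun r => (ρ r).asModule) r'
    have hf (m : M) : φ m r = ∑ r', f r' (m r') := by
      conv_lhs => rw [← Finset.univ_sum_single m, map_sum, Finset.sum_apply]
      rfl
    have hne (r') (hr : r' ≠ r) : f r' = 0 := by
      by_contra hf0
      have := (LinearMap.bijective_or_eq_zero (f r')).resolve_right hf0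
      exact hr (hdist r' r (repIso_of_linearEquiv (LinearEquiv.ofBijective (f r') this)))
    obtain ⟨c, hc⟩ := (IsSimpleModule.algebraMap_end_bijective_of_isAlgClosed
      (A := ℂ[K]) (V := (ρ r).asModule) ℂ).2 (f r)
    refine ⟨c, fun m => ?_⟩
    rw [hf, Finset.sum_eq_single r (fun r' _ hr => by rw [hne r' hr]; rfl) (by simp), ← hc]
    rfl
  let F : Module.End (Module.End ℂ[K] M) M :=
    { toFun := fun m r => B r (m r)
      map_add' := fun x y => funext fun r => map_add (B r) _ _
      map_smul' := fun φ m => funext fun r => by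
        obtain ⟨c, hc⟩ := schur φ r
        refine (congrArg (B r) (hc m)).trans ?_
        exact (map_smul (B r) c _).trans (hc fun r => B r (m r)).symm }
  let b (r) := Module.finBasis ℂ (V r)
  let s : Finset M := Finset.univ.image
    fun p : (Σ r, Fin (Module.finrank ℂ (V r))) => Pi.single p.1 (b p.1 p.2)
  obtain ⟨a, ha⟩ := jacobson_density F s
  refine ⟨a, funext fun r => (b r).ext fun i => ?_⟩
  have := congrFun (ha (Pi.single r (b r i)) (Finset.mem_image.2 ⟨⟨r, i⟩, by simp, rfl⟩)) r
  have h1 : (Pi.single r (b r i) : ∀ r, V r) r = b r i := Pi.single_eq_same r _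
  change B r ((Pi.single r (b r i) : ∀ r, V r) r) =
    (ρ r).asAlgebraHom a ((Pi.single r (b r i) : ∀ r, V r) r) at this
  rw [h1] at this
  exact this.symm

end Wedderburn

section GroupExtension

open scoped MonoidAlgebra

variable {H Q : Type} [Group H] [Group Q] (j : H →* Q)

/-- The inclusion of the group algebra of `ker j` into that of `H`. -/
def kerIncl : ℂ[j.ker] →ₐ[ℂ] ℂ[H] := MonoidAlgebra.mapDomainAlgHom ℂ ℂ j.ker.subtype

/-- Conjugation `g ↦ h⁻¹ * g * h` on the group algebra of `ker j`. -/
def kerConj (h : H) : ℂ[j.ker] →ₐ[ℂ] ℂ[j.ker] :=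
  MonoidAlgebra.mapDomainAlgHom ℂ ℂ (MulAut.conjNormal h⁻¹ : MulAut j.ker).toMonoidHom

theorem kerIncl_single (g : j.ker) (x : ℂ) :
    kerIncl j (MonoidAlgebra.single g x) = MonoidAlgebra.single (g : H) x := by
  simp [kerIncl]

theorem kerConj_single (h : H) (g : j.ker) (x : ℂ) :
    kerConj j h (MonoidAlgebra.single g x) =
      MonoidAlgebra.single (MulAut.conjNormal h⁻¹ g) x := by
  simp [kerConj]

theorem kerIncl_mul_of (h : H) (a : ℂ[j.ker]) :
    kerIncl j a * MonoidAlgebra.of ℂ H h = MonoidAlgebra.of ℂ H h * kerIncl j (kerConj j h a) := by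
  induction a using MonoidAlgebra.induction_linear with
  | zero => simp
  | add x y hx hy => simp only [map_add, add_mul, mul_add, hx, hy]
  | single g x =>
    rw [kerConj_single, kerIncl_single, kerIncl_single, MonoidAlgebra.of_apply,
      MonoidAlgebra.single_mul_single, MonoidAlgebra.single_mul_single]
    simp [mul_assoc]

theorem of_mul_of_mul_kerIncl {s : Q → H} (hs : ∀ q, j (s q) = q) (q₁ q₂ : Q) (y : ℂ[j.ker]) :
    MonoidAlgebra.of ℂ H (s q₁) * MonoidAlgebra.of ℂ H (s q₂) * kerIncl j y =
      MonoidAlgebra.of ℂ H (s (q₁ * q₂)) * kerIncl j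
        (kerConj j (s (q₁ * q₂)) (MonoidAlgebra.single (tau j s hs q₁ q₂) 1) * y) := by
  rw [map_mul, ← mul_assoc, ← kerIncl_mul_of, kerIncl_single, MonoidAlgebra.of_apply,
    MonoidAlgebra.of_apply, MonoidAlgebra.of_apply, MonoidAlgebra.single_mul_single,
    MonoidAlgebra.single_mul_single]
  simp [tau]

variable [Fintype Q] (s : Q → H)

/-- The element `∑ q, s q * a q` of the group algebra of `H`. -/
def cosetSum : (Q → ℂ[j.ker]) →ₗ[ℂ] ℂ[H] :=
  ∑ q, LinearMap.mulLeft ℂ (MonoidAlgebra.of ℂ H (s q)) ∘ₗ (kerIncl j).toLinearMap ∘ₗ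
    LinearMap.proj q

theorem cosetSum_apply (a : Q → ℂ[j.ker]) :
    cosetSum j s a = ∑ q, MonoidAlgebra.of ℂ H (s q) * kerIncl j (a q) := by
  simp [cosetSum]

theorem kerIncl_mul_cosetSum_mul_kerIncl (x y : ℂ[j.ker]) (a : Q → ℂ[j.ker]) :
    kerIncl j x * cosetSum j s a * kerIncl j y =
      cosetSum j s fun q => kerConj j (s q) x * a q * y := by
  simp only [cosetSum_apply, Finset.mul_sum, Finset.sum_mul]
  refine Finset.sum_congr rfl fun q _ => ?_
  rw [← mul_assoc, kerIncl_mul_of, map_mul, map_mul, mul_assoc, mul_assoc, mul_assoc]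

variable {s} (hs : ∀ q, j (s q) = q)
include hs

theorem cosetSum_injective : Function.Injective (cosetSum j s) := by
  classical
  rw [injective_iff_map_eq_zero]
  intro a ha
  funext q₀
  have hinj : Function.Injective fun g : j.ker => s q₀ * (g : H) := fun g g' h =>
    Subtype.ext (mul_left_cancel h)
  let π : ℂ[H] →+ ℂ[j.ker] := MonoidAlgebra.comapDomainAddMonoidHom _ hinj
  have hπ (q : Q) (b : ℂ[j.ker]) : π (MonoidAlgebra.of ℂ H (s q) * kerIncl j b) =
      if q = q₀ then b else 0 := by
    induction b using MonoidAlgebra.induction_linear with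
    | zero => simp
    | add x y hx hy =>
      rw [map_add, mul_add, map_add, hx, hy]
      split_ifs <;> simp
    | single g x =>
      rw [kerIncl_single, MonoidAlgebra.of_apply, MonoidAlgebra.single_mul_single, one_mul]
      split_ifs with hq
      · subst hq
        exact MonoidAlgebra.comapDomain_single_map (fun g : j.ker => s q * (g : H)) hinj g x
      · refine MonoidAlgebra.comapDomain_single_of_not_mem_range ?_ hinj
        rintro ⟨g', hg'⟩
        apply hq
        have h1 := congrArg j hg'
        have h2 := g.2
        have h3 := g'.2
        rw [MonoidHom.mem_ker] at h2 h3
        simpa [hs, h2, h3] using h1.symm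
  have := congrArg π ha
  rw [cosetSum_apply, map_sum, Finset.sum_congr rfl fun q _ => hπ q (a q)] at this
  simpa using this

theorem cosetSum_surjective : Function.Surjective (cosetSum j s) := by
  classical
  intro x
  induction x using MonoidAlgebra.induction_linear with
  | zero => exact ⟨0, map_zero _⟩
  | add x y hx hy =>
    obtain ⟨a, rfl⟩ := hx
    obtain ⟨b, rfl⟩ := hy
    exact ⟨a + b, map_add _ _ _⟩
  | single h x =>
    refine ⟨Pi.single (j h) (MonoidAlgebra.single ⟨(s (j h))⁻¹ * h, ?_⟩ x), ?_⟩
    · simp [MonoidHom.mem_ker, hs]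
    · rw [cosetSum_apply, Finset.sum_eq_single (j h) (fun q _ hq => by simp [Pi.single_eq_of_ne hq])
        (by simp), Pi.single_eq_same, kerIncl_single, MonoidAlgebra.of_apply,
        MonoidAlgebra.single_mul_single]
      simp

theorem cosetSum_mul_cosetSum (a b : Q → ℂ[j.ker]) :
    cosetSum j s a * cosetSum j s b = cosetSum j s fun q => ∑ q₁,
      kerConj j (s q) (MonoidAlgebra.single (tau j s hs q₁ (q₁⁻¹ * q)) 1) *
        (kerConj j (s (q₁⁻¹ * q)) (a q₁) * b (q₁⁻¹ * q)) := by
  have hterm (q₁ q₂ : Q) : MonoidAlgebra.of ℂ H (s q₁) * kerIncl j (a q₁) *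
      (MonoidAlgebra.of ℂ H (s q₂) * kerIncl j (b q₂)) =
      MonoidAlgebra.of ℂ H (s (q₁ * q₂)) * kerIncl j
        (kerConj j (s (q₁ * q₂)) (MonoidAlgebra.single (tau j s hs q₁ q₂) 1) *
          (kerConj j (s q₂) (a q₁) * b q₂)) := by
    rw [← of_mul_of_mul_kerIncl, map_mul, mul_assoc, ← mul_assoc (kerIncl j (a q₁)),
      kerIncl_mul_of]
    simp only [mul_assoc]
  simp only [cosetSum_apply, Finset.sum_mul_sum, hterm]
  simp only [map_sum, Finset.mul_sum]
  rw [Finset.sum_comm (f := fun q q₁ => MonoidAlgebra.of ℂ H (s q) * kerIncl j _)]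
  refine Finset.sum_congr rfl fun q₁ _ => ?_
  refine Fintype.sum_equiv (Equiv.mulLeft q₁) _ _ fun q₂ => ?_
  simp

end GroupExtension

section Intertwiners

open scoped MonoidAlgebra

variable {Ghat : Type} {V : Ghat → Type} [∀ r, AddCommGroup (V r)] [∀ r, Module ℂ (V r)]

theorem castHom_bijective {a b : Ghat} (h : a = b) : Function.Bijective (castHom V h) := by
  subst h
  exact Function.bijective_id

theorem castHom_trans {a b d : Ghat} (h : a = b) (h' : b = d) (v : V a) :
    castHom V h' (castHom V h v) = castHom V (h.trans h') v := by
  subst h h'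
  rfl

theorem castHom_asAlgebraHom {K : Type} [Group K] (ρ : ∀ r, Representation ℂ K (V r))
    {a b : Ghat} (h : a = b) (x : ℂ[K]) (v : V a) :
    castHom V h ((ρ a).asAlgebraHom x v) = (ρ b).asAlgebraHom x (castHom V h v) := by
  subst h
  rfl

variable {H Q : Type} [Group H] [Group Q] {j : H →* Q} {s : Q → H}
  {ρ : ∀ r, Representation ℂ j.ker (V r)} {act : Q → Ghat → Ghat}
  (T : ∀ (q : Q) (r : Ghat), V r ≃ₗ[ℂ] V (act q r))

theorem asAlgebraHom_kerConj_apply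
    (hT : ∀ (q : Q) (r : Ghat) (g : j.ker) (v : V r),
      T q r (conjRep j (ρ r) (s q) g v) = ρ (act q r) g (T q r v))
    (q : Q) (r : Ghat) (a : ℂ[j.ker]) (v : V r) :
    (ρ (act q r)).asAlgebraHom (kerConj j (s q) a) (T q r v) =
      T q r ((ρ r).asAlgebraHom a v) := by
  induction a using MonoidAlgebra.induction_linear with
  | zero => simp
  | add x y hx hy => simp only [map_add, LinearMap.add_apply, hx, hy]
  | single g x =>
    rw [kerConj_single, Representation.asAlgebraHom_single, Representation.asAlgebraHom_single,
      LinearMap.smul_apply, LinearMap.smul_apply, map_smul, ← hT]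
    simp [conjRep]

omit [Group Q] in
theorem castHom_intertwiner (q : Q) {r r' : Ghat} (h : r' = r) (h' : act q r' = r)
    (h'' : act q r = r) (w : V r') :
    castHom V h' (T q r' w) = castHom V h'' (T q r (castHom V h w)) := by
  subst h
  rfl

open Classical in
/-- The intertwiner `T q r` as an automorphism of `V r`, for `q` in the stabilizer of `r`. -/
def stabIntertwiner (r : Ghat) (q : Q) : V r ≃ₗ[ℂ] V r :=
  if h : act q r = r then
    (T q r).trans (LinearEquiv.ofBijective (castHom V h) (castHom_bijective h))
  else LinearEquiv.refl ℂ (V r)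

variable {T}

omit [Group Q] in
theorem stabIntertwiner_apply {r : Ghat} {q : Q} (h : act q r = r) (v : V r) :
    stabIntertwiner T r q v = castHom V h (T q r v) := by
  rw [stabIntertwiner, dif_pos h]
  rfl

theorem asAlgebraHom_kerConj_stabIntertwiner
    (hT : ∀ (q : Q) (r : Ghat) (g : j.ker) (v : V r),
      T q r (conjRep j (ρ r) (s q) g v) = ρ (act q r) g (T q r v))
    {q : Q} {r : Ghat} (h : act q r = r) (a : ℂ[j.ker]) (v : V r) :
    (ρ r).asAlgebraHom (kerConj j (s q) a) (stabIntertwiner T r q v) =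
      stabIntertwiner T r q ((ρ r).asAlgebraHom a v) := by
  rw [stabIntertwiner_apply h, stabIntertwiner_apply h, ← castHom_asAlgebraHom,
    asAlgebraHom_kerConj_apply T hT]

theorem stabIntertwiner_comp {hs : ∀ q, j (s q) = q}
    (hactmul : ∀ (q₁ q₂ : Q) (r : Ghat), act q₂ (act q₁ r) = act (q₁ * q₂) r)
    {c : Ghat → Q → Q → ℂ}
    (hcdef : ∀ (r : Ghat) (q₁ q₂ : Q) (v : V r),
      T q₂ (act q₁ r) (T q₁ r v) =
        c r q₁ q₂ • castHom V (hactmul q₁ q₂ r).symm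
          (T (q₁ * q₂) r (ρ r ((tau j s hs q₁ q₂)⁻¹) v)))
    {r : Ghat} {q₁ q₂ : Q} (h₁ : act q₁ r = r) (h₂ : act q₂ r = r) (v : V r) :
    stabIntertwiner T r q₂ (stabIntertwiner T r q₁ v) =
      c r q₁ q₂ • stabIntertwiner T r (q₁ * q₂) (ρ r ((tau j s hs q₁ q₂)⁻¹) v) := by
  have h₁₂ : act (q₁ * q₂) r = r := by rw [← hactmul, h₁, h₂]
  have h' : act q₂ (act q₁ r) = r := by rw [h₁, h₂]
  rw [stabIntertwiner_apply h₁, stabIntertwiner_apply h₂, stabIntertwiner_apply h₁₂,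
    ← castHom_intertwiner T q₂ h₁ h' h₂, hcdef, map_smul, castHom_trans]

end Intertwiners

/-- A rank one idempotent. -/
theorem exists_rank_one_idempotent (V : Type) [AddCommGroup V] [Module ℂ V]
    [FiniteDimensional ℂ V] [Nontrivial V] :
    ∃ E : Module.End ℂ V, E ≠ 0 ∧ E * E = E ∧ (∀ B : Module.End ℂ V, ∃ k : ℂ, E * B * E = k • E) ∧
      ∃ (n : ℕ) (B C : Fin n → Module.End ℂ V), ∑ i, B i * E * C i = 1 := by
  obtain ⟨v, hv⟩ := exists_ne (0 : V)
  obtain ⟨f, hf⟩ := Module.Projective.exists_dual_ne_zero ℂ hv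
  let l : V →ₗ[ℂ] ℂ := (f v)⁻¹ • f
  have hl : l v = 1 := by simp [l, hf]
  let b := Module.finBasis ℂ V
  refine ⟨l.smulRight v, fun h => ?_, ?_, fun B => ⟨l (B v), ?_⟩, _,
    fun i => l.smulRight (b i), fun i => (b.coord i).smulRight v, ?_⟩
  · have := LinearMap.congr_fun h v
    simp only [LinearMap.smulRight_apply, hl, one_smul, LinearMap.zero_apply] at this
    exact hv this
  · ext w
    simp [hl]
  · ext w
    simp [smul_smul, mul_comm]
  · ext w
    simp only [LinearMap.sum_apply, Module.End.mul_apply, LinearMap.smulRight_apply, map_smul, hl,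
      one_smul, Module.End.one_apply]
    exact b.sum_repr w

section StabilizerCorner

open scoped MonoidAlgebra

variable {H Q Ghat : Type} [Group H] [Group Q] [Fintype Q] {j : H →* Q} {s : Q → H}
  {V : Ghat → Type} [∀ r, AddCommGroup (V r)] [∀ r, Module ℂ (V r)]
  {ρ : ∀ r, Representation ℂ j.ker (V r)} {act : Q → Ghat → Ghat}
  {T : ∀ (q : Q) (r : Ghat), V r ≃ₗ[ℂ] V (act q r)}
  (Ψ : ℂ[j.ker] ≃ₐ[ℂ] ∀ r, Module.End ℂ (V r))
  (E : ∀ r, Module.End ℂ (V r))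

variable (T) in
/-- The coefficients, in `ℂ[ker j]`, of the image of a family of twisted group algebra elements. -/
def stabCoeff (f : Ghat → Q → ℂ) (q : Q) : ℂ[j.ker] :=
  Ψ.symm fun r => f r q • ((stabIntertwiner T r q).toLinearMap * E r)

omit [Fintype Q] in
theorem apply_stabCoeff (f : Ghat → Q → ℂ) (q : Q) (r : Ghat) (v : V r) :
    Ψ (stabCoeff T Ψ E f q) r v = f r q • stabIntertwiner T r q (E r v) := by
  simp [stabCoeff]

variable (s T) in
/-- The image in `ℂ[H]` of a family of twisted group algebra elements. -/
def stabEmbed (f : Ghat → Q → ℂ) : ℂ[H] := cosetSum j s (stabCoeff T Ψ E f)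

theorem stabEmbed_add (f g : Ghat → Q → ℂ) :
    stabEmbed s T Ψ E (fun r q => f r q + g r q) =
      stabEmbed s T Ψ E f + stabEmbed s T Ψ E g := by
  rw [stabEmbed, stabEmbed, stabEmbed, ← map_add]
  congr 1
  funext q
  refine Ψ.injective (funext fun r => LinearMap.ext fun v => ?_)
  simp only [Pi.add_apply, map_add, LinearMap.add_apply, apply_stabCoeff, add_smul]

theorem stabEmbed_smul (x : ℂ) (f : Ghat → Q → ℂ) :
    stabEmbed s T Ψ E (fun r q => x * f r q) = x • stabEmbed s T Ψ E f := by
  rw [stabEmbed, stabEmbed, ← map_smul]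
  congr 1
  funext q
  refine Ψ.injective (funext fun r => LinearMap.ext fun v => ?_)
  simp only [Pi.smul_apply, map_smul, LinearMap.smul_apply, apply_stabCoeff, mul_smul]

theorem stabEmbed_injective (hs : ∀ q, j (s q) = q) {f g : Ghat → Q → ℂ}
    (h : stabEmbed s T Ψ E f = stabEmbed s T Ψ E g) {r : Ghat} (hr : E r ≠ 0) (q : Q) :
    f r q = g r q := by
  have h₁ := congrFun (cosetSum_injective j hs h) q
  obtain ⟨v, hv⟩ : ∃ v, E r v ≠ 0 := by
    by_contra! h₀
    exact hr (LinearMap.ext h₀)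
  have h₂ : Ψ (stabCoeff T Ψ E f q) r v = Ψ (stabCoeff T Ψ E g q) r v := by rw [h₁]
  rw [apply_stabCoeff, apply_stabCoeff] at h₂
  exact smul_left_injective ℂ ((stabIntertwiner T r q).map_ne_zero_iff.2 hv) h₂

variable {Ψ E} (hΨ : ∀ a r, Ψ a r = (ρ r).asAlgebraHom a)
  (hT : ∀ (q : Q) (r : Ghat) (g : j.ker) (v : V r),
    T q r (conjRep j (ρ r) (s q) g v) = ρ (act q r) g (T q r v))
include hΨ hT

omit [Fintype Q] in
theorem apply_kerConj_intertwiner (q : Q) (r : Ghat) (a : ℂ[j.ker]) (v : V r) :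
    Ψ (kerConj j (s q) a) (act q r) (T q r v) = T q r (Ψ a r v) := by
  rw [hΨ, hΨ, asAlgebraHom_kerConj_apply T hT]

omit [Fintype Q] in
theorem apply_kerConj_stabIntertwiner {q : Q} {r : Ghat} (h : act q r = r) (a : ℂ[j.ker])
    (v : V r) :
    Ψ (kerConj j (s q) a) r (stabIntertwiner T r q v) = stabIntertwiner T r q (Ψ a r v) := by
  rw [hΨ, hΨ, asAlgebraHom_kerConj_stabIntertwiner hT h]

theorem stabEmbed_mul {hs : ∀ q, j (s q) = q}
    (hactmul : ∀ (q₁ q₂ : Q) (r : Ghat), act q₂ (act q₁ r) = act (q₁ * q₂) r)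
    {c : Ghat → Q → Q → ℂ}
    (hcdef : ∀ (r : Ghat) (q₁ q₂ : Q) (v : V r),
      T q₂ (act q₁ r) (T q₁ r v) =
        c r q₁ q₂ • castHom V (hactmul q₁ q₂ r).symm
          (T (q₁ * q₂) r (ρ r ((tau j s hs q₁ q₂)⁻¹) v)))
    (hE : ∀ r, E r * E r = E r) {f g : Ghat → Q → ℂ}
    (hf : ∀ r q, act q r ≠ r → f r q = 0) (hg : ∀ r q, act q r ≠ r → g r q = 0) :
    stabEmbed s T Ψ E f * stabEmbed s T Ψ E g =
      stabEmbed s T Ψ E fun r q =>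
        ∑ q₁ : Q, c r q₁ (q₁⁻¹ * q) * f r q₁ * g r (q₁⁻¹ * q) := by
  have hE' (r : Ghat) (v : V r) : E r (E r v) = E r v := LinearMap.congr_fun (hE r) v
  rw [stabEmbed, stabEmbed, stabEmbed, cosetSum_mul_cosetSum j hs]
  congr 1
  funext q
  refine Ψ.injective (funext fun r => LinearMap.ext fun v => ?_)
  rw [apply_stabCoeff, Finset.sum_smul, map_sum, Finset.sum_apply, LinearMap.sum_apply]
  refine Finset.sum_congr rfl fun q₁ _ => ?_
  rw [map_mul, map_mul, Pi.mul_apply, Pi.mul_apply, Module.End.mul_apply, Module.End.mul_apply,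
    apply_stabCoeff]
  by_cases h₂ : act (q₁⁻¹ * q) r = r
  swap
  · simp [hg r _ h₂]
  rw [map_smul, apply_kerConj_stabIntertwiner hΨ hT h₂, apply_stabCoeff, hE']
  by_cases h₁ : act q₁ r = r
  swap
  · simp [hf r _ h₁]
  have h : act q r = r := by
    rw [← mul_inv_cancel_left q₁ q, ← hactmul, h₁, h₂]
  rw [map_smul, map_smul, map_smul, stabIntertwiner_comp hactmul hcdef h₁ h₂, mul_inv_cancel_left,
    map_smul, apply_kerConj_stabIntertwiner hΨ hT h, hΨ, Representation.asAlgebraHom_single_one,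
    ← Module.End.mul_apply, ← map_mul, mul_inv_cancel, map_one, Module.End.one_apply, smul_smul,
    smul_smul]
  congr 1
  ring

theorem kerIncl_mul_stabEmbed (hE : ∀ r, E r * E r = E r) {f : Ghat → Q → ℂ}
    (hf : ∀ r q, act q r ≠ r → f r q = 0) :
    kerIncl j (Ψ.symm E) * stabEmbed s T Ψ E f = stabEmbed s T Ψ E f := by
  have hE' (r : Ghat) (v : V r) : E r (E r v) = E r v := LinearMap.congr_fun (hE r) v
  rw [stabEmbed, ← mul_one (kerIncl j _ * _), ← map_one (kerIncl j),
    kerIncl_mul_cosetSum_mul_kerIncl]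
  congr 1
  funext q
  refine Ψ.injective (funext fun r => LinearMap.ext fun v => ?_)
  rw [mul_one, map_mul, Pi.mul_apply, Module.End.mul_apply, apply_stabCoeff]
  by_cases h : act q r = r
  · rw [map_smul, apply_kerConj_stabIntertwiner hΨ hT h, AlgEquiv.apply_symm_apply, hE']
  · simp [hf r q h]

theorem exists_stabEmbed_eq (hs : ∀ q, j (s q) = q)
    (hEB : ∀ r B, ∃ k : ℂ, E r * B * E r = k • E r)
    (hsurj : ∀ q, Function.Surjective (act q))
    (hEact : ∀ q r, E r ≠ 0 → E (act q r) ≠ 0 → act q r = r) (a : ℂ[H]) :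
    ∃ f : Ghat → Q → ℂ, (∀ r, E r = 0 → ∀ q, f r q = 0) ∧ (∀ r q, act q r ≠ r → f r q = 0) ∧
      stabEmbed s T Ψ E f = kerIncl j (Ψ.symm E) * a * kerIncl j (Ψ.symm E) := by
  obtain ⟨b, rfl⟩ := cosetSum_surjective j hs a
  have key (r : Ghat) (q : Q) : ∃ k : ℂ, (E r = 0 → k = 0) ∧ (act q r ≠ r → k = 0) ∧
      ∀ v, Ψ (kerConj j (s q) (Ψ.symm E) * b q * Ψ.symm E) r v =
        k • stabIntertwiner T r q (E r v) := by
    simp only [map_mul, Pi.mul_apply, Module.End.mul_apply, AlgEquiv.apply_symm_apply]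
    by_cases hr : E r = 0
    · exact ⟨0, fun _ => rfl, fun _ => rfl, by simp [hr]⟩
    by_cases h : act q r = r
    · obtain ⟨k, hk⟩ := hEB r ((stabIntertwiner T r q).symm.toLinearMap * Ψ (b q) r)
      refine ⟨k, fun h₀ => (hr h₀).elim, fun h₀ => (h₀ h).elim, fun v => ?_⟩
      have hk' := LinearMap.congr_fun hk v
      simp only [Module.End.mul_apply, LinearMap.smul_apply, LinearEquiv.coe_coe] at hk'
      rw [← map_smul, ← hk', ← LinearEquiv.apply_symm_apply (stabIntertwiner T r q)
        (Ψ (b q) r (E r v)), apply_kerConj_stabIntertwiner hΨ hT h, AlgEquiv.apply_symm_apply,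
        LinearEquiv.symm_apply_apply]
    · refine ⟨0, fun _ => rfl, fun _ => rfl, fun v => ?_⟩
      obtain ⟨r₀, rfl⟩ := hsurj q r
      have h₀ : E r₀ = 0 := by
        by_contra h₀
        exact h (congrArg (act q) (hEact q r₀ h₀ hr))
      obtain ⟨w, hw⟩ := (T q r₀).surjective (Ψ (b q) (act q r₀) (E (act q r₀) v))
      rw [← hw, apply_kerConj_intertwiner hΨ hT, AlgEquiv.apply_symm_apply, h₀]
      simp
  choose f hf₀ hf₁ hf using key
  refine ⟨f, fun r hr q => hf₀ r q hr, hf₁, ?_⟩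
  rw [stabEmbed, kerIncl_mul_cosetSum_mul_kerIncl]
  congr 1
  funext q
  refine Ψ.injective (funext fun r => LinearMap.ext fun v => ?_)
  rw [apply_stabCoeff, hf]

omit [Fintype Q] in
theorem one_mem_span_corner [Fintype Ghat] (hinj : ∀ q, Function.Injective (act q))
    (hsurj : ∀ q, Function.Surjective (act q))
    (hE : ∀ r, ∃ q, ∃ (n : ℕ) (B C : Fin n → Module.End ℂ (V (act q r))),
      ∑ i, B i * E (act q r) * C i = 1) :
    (1 : ℂ[H]) ∈ Submodule.span ℂ {x | ∃ a b, x = a * kerIncl j (Ψ.symm E) * b} := by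
  classical
  set S := Submodule.span ℂ {x : ℂ[H] | ∃ a b, x = a * kerIncl j (Ψ.symm E) * b}
  have hmul (x y z : ℂ[H]) (hy : y ∈ S) : x * y * z ∈ S := by
    induction hy using Submodule.span_induction with
    | mem y hy =>
      obtain ⟨a, b, rfl⟩ := hy
      exact Submodule.subset_span ⟨x * a, b * z, by simp only [mul_assoc]⟩
    | zero => simp
    | add y y' _ _ hy hy' => simpa only [mul_add, add_mul] using S.add_mem hy hy'
    | smul k y _ hy => simpa only [mul_smul_comm, smul_mul_assoc] using S.smul_mem k hy
  let z (r : Ghat) : ℂ[j.ker] := Ψ.symm (Pi.single r 1)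
  have hz (q : Q) (r : Ghat) : kerConj j (s q) (z r) = z (act q r) := by
    refine Ψ.injective (funext fun r₁ => LinearMap.ext fun v => ?_)
    obtain ⟨r₀, rfl⟩ := hsurj q r₁
    obtain ⟨w, rfl⟩ := (T q r₀).surjective v
    rw [apply_kerConj_intertwiner hΨ hT, AlgEquiv.apply_symm_apply, AlgEquiv.apply_symm_apply]
    by_cases h : r₀ = r
    · subst h
      simp
    · rw [Pi.single_eq_of_ne h, Pi.single_eq_of_ne ((hinj q).ne h)]
      simp
  have hzS (r : Ghat) (n : ℕ) (B C : Fin n → Module.End ℂ (V r))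
      (h : ∑ i, B i * E r * C i = 1) : kerIncl j (z r) ∈ S := by
    have hsum : z r = ∑ i, Ψ.symm (Pi.single r (B i)) * Ψ.symm E * Ψ.symm (Pi.single r (C i)) := by
      refine Ψ.injective (funext fun r₁ => ?_)
      simp only [z, map_sum, map_mul, AlgEquiv.apply_symm_apply, Finset.sum_apply, Pi.mul_apply]
      by_cases h₁ : r₁ = r
      · subst h₁
        simp [h]
      · simp [Pi.single_eq_of_ne h₁]
    rw [hsum, map_sum]
    refine S.sum_mem fun i _ => Submodule.subset_span
      ⟨kerIncl j (Ψ.symm (Pi.single r (B i))), kerIncl j (Ψ.symm (Pi.single r (C i))), ?_⟩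
    rw [map_mul, map_mul]
  have hone : (1 : ℂ[j.ker]) = ∑ r, z r := by
    rw [← map_sum, ← map_one Ψ.symm]
    exact congrArg Ψ.symm (Finset.univ_sum_single (1 : ∀ r, Module.End ℂ (V r))).symm
  rw [← map_one (kerIncl j), hone, map_sum]
  refine S.sum_mem fun r _ => ?_
  obtain ⟨q, n, B, C, h⟩ := hE r
  have hconj := kerIncl_mul_of j (s q) (z r)
  rw [hz] at hconj
  have hr : kerIncl j (z r) = MonoidAlgebra.of ℂ H (s q) * kerIncl j (z (act q r)) *
      MonoidAlgebra.of ℂ H (s q)⁻¹ := by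
    rw [← hconj, mul_assoc, ← map_mul, mul_inv_cancel, map_one, mul_one]
  rw [hr]
  exact hmul _ _ _ (hzS _ n B C h)

end StabilizerCorner

/-- Choosing a representative `[ρ_O] ∈ O` in each orbit `O` of the `Q`-action
on `Ĝ` (encoded by a map `rep : Ĝ → Ĝ`, constant on orbits, with `rep r` in the orbit of `r`),
the group algebra `ℂH` is Morita equivalent to the direct sum, over all `Q`-orbits `O ⊆ Ĝ`, of
the twisted group algebras `C(Stab([ρ_O]), c_{[ρ_O]})`, where `c_{[ρ_O]}` is the restriction
of `c^{[ρ_O]}` to the stabilizer.  (The direct sum is presented as any ℂ-algebra structure on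
`SumAlg` whose addition, scalar multiplication and multiplication are the canonical
summand-wise twisted-group-algebra operations.) -/
theorem stmt9 {H Q : Type} [Group H] [Group Q] [Fintype H] [Fintype Q]
    (j : H →* Q) (hj : Function.Surjective j)
    (s : Q → H) (hs : ∀ q, j (s q) = q) (hs1 : s 1 = 1)
    {Ghat : Type} [Fintype Ghat]
    (V : Ghat → Type) [∀ r, AddCommGroup (V r)] [∀ r, Module ℂ (V r)]
    [∀ r, FiniteDimensional ℂ (V r)]
    (ρ : ∀ r, Representation ℂ j.ker (V r))
    (hirr : ∀ r, IsIrredRep (ρ r))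
    (hdist : ∀ r r', RepIso (ρ r) (ρ r') → r = r')
    (hcomplete : ∀ (W : Type) [AddCommGroup W] [Module ℂ W] [FiniteDimensional ℂ W]
      (σ : Representation ℂ j.ker W), IsIrredRep σ → ∃ r, RepIso σ (ρ r))
    (act : Q → Ghat → Ghat)
    (hact : ∀ q r, RepIso (conjRep j (ρ r) (s q)) (ρ (act q r)))
    (hact1 : ∀ r, act 1 r = r)
    (hactmul : ∀ (q₁ q₂ : Q) (r : Ghat), act q₂ (act q₁ r) = act (q₁ * q₂) r)
    (T : ∀ (q : Q) (r : Ghat), V r ≃ₗ[ℂ] V (act q r))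
    (hT : ∀ (q : Q) (r : Ghat) (g : j.ker) (v : V r),
      T q r (conjRep j (ρ r) (s q) g v) = ρ (act q r) g (T q r v))
    (hT1 : ∀ (r : Ghat) (v : V r), T 1 r v = castHom V (hact1 r).symm v)
    (c : Ghat → Q → Q → ℂ)
    (hcdef : ∀ (r : Ghat) (q₁ q₂ : Q) (v : V r),
      T q₂ (act q₁ r) (T q₁ r v) =
        c r q₁ q₂ • castHom V (hactmul q₁ q₂ r).symm
          (T (q₁ * q₂) r (ρ r ((tau j s hs q₁ q₂)⁻¹) v)))
    -- a choice of representatives of the `Q`-orbits in `Ĝ`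
    (rep : Ghat → Ghat)
    (hrep_orbit : ∀ r, ∃ q : Q, act q r = rep r)
    (hrep_const : ∀ r r', (∃ q : Q, act q r = r') → rep r = rep r') :
    ∀ (instR : Ring (SumAlg Ghat Q act rep)) (instA : Algebra ℂ (SumAlg Ghat Q act rep)),
      (∀ f₁ f₂ : SumAlg Ghat Q act rep,
        (f₁ + f₂).coef = fun r q => f₁.coef r q + f₂.coef r q) →
      (∀ (a : ℂ) (f : SumAlg Ghat Q act rep), (a • f).coef = fun r q => a * f.coef r q) →
      (∀ f₁ f₂ : SumAlg Ghat Q act rep, (f₁ * f₂).coef = fun r q =>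
        ∑ q₁ : Q, c r q₁ (q₁⁻¹ * q) * f₁.coef r q₁ * f₂.coef r (q₁⁻¹ * q)) →
      MoritaEquiv (MonoidAlgebra ℂ H) (SumAlg Ghat Q act rep) := by
  classical
  intro instR instA hadd hsmul hmul
  let Ψ : MonoidAlgebra ℂ j.ker ≃ₐ[ℂ] ∀ r, Module.End ℂ (V r) :=
    AlgEquiv.ofBijective (actionHom V ρ)
      ⟨actionHom_injective hcomplete, actionHom_surjective hirr hdist⟩
  have hΨ (a : MonoidAlgebra ℂ j.ker) (r : Ghat) : Ψ a r = (ρ r).asAlgebraHom a := rfl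
  have hE₀ (r : Ghat) := haveI := (hirr r).1; exists_rank_one_idempotent (V r)
  choose E₀ hE₀_ne hE₀_sq hE₀_mul hE₀_full using hE₀
  let E (r : Ghat) : Module.End ℂ (V r) := if r ∈ Set.range rep then E₀ r else 0
  have hE_mem {r : Ghat} (hr : r ∈ Set.range rep) : E r = E₀ r := if_pos hr
  have hE_notMem {r : Ghat} (hr : r ∉ Set.range rep) : E r = 0 := if_neg hr
  have hE_ne {r : Ghat} (hr : r ∈ Set.range rep) : E r ≠ 0 := hE_mem hr ▸ hE₀_ne r
  have hE_range {r : Ghat} (hr : E r ≠ 0) : r ∈ Set.range rep := not_imp_comm.1 hE_notMem hr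
  have hE_sq (r : Ghat) : E r * E r = E r := by
    by_cases hr : r ∈ Set.range rep
    · rw [hE_mem hr, hE₀_sq]
    · rw [hE_notMem hr, mul_zero]
  have hE_mul (r : Ghat) (B : Module.End ℂ (V r)) : ∃ k : ℂ, E r * B * E r = k • E r := by
    by_cases hr : r ∈ Set.range rep
    · rw [hE_mem hr]
      exact hE₀_mul r B
    · exact ⟨0, by rw [hE_notMem hr, mul_zero, smul_zero]⟩
  have hrep_range {r : Ghat} (hr : r ∈ Set.range rep) : rep r = r := by
    obtain ⟨r, rfl⟩ := hr
    exact (hrep_const r (rep r) (hrep_orbit r)).symm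
  have hE_act (q : Q) (r : Ghat) (h₁ : E r ≠ 0) (h₂ : E (act q r) ≠ 0) : act q r = r := by
    rw [← hrep_range (hE_range h₂), ← hrep_const r _ ⟨q, rfl⟩, hrep_range (hE_range h₁)]
  have hact_inv (q : Q) (r : Ghat) : act q⁻¹ (act q r) = r := by
    rw [hactmul, mul_inv_cancel, hact1]
  have hact_inj (q : Q) : Function.Injective (act q) := Function.LeftInverse.injective (hact_inv q)
  have hact_surj (q : Q) : Function.Surjective (act q) := fun r =>
    ⟨act q⁻¹ r, by simpa using hact_inv q⁻¹ r⟩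
  let φ : SumAlg Ghat Q act rep →ₙₐ[ℂ] MonoidAlgebra ℂ H :=
    { toFun f := stabEmbed s T Ψ E f.coef
      map_smul' x f := by
        rw [hsmul, stabEmbed_smul]
        rfl
      map_zero' := by
        rw [← zero_smul ℂ (0 : SumAlg Ghat Q act rep), hsmul, stabEmbed_smul, zero_smul]
      map_add' f g := by rw [hadd, stabEmbed_add]
      map_mul' f g := by
        rw [hmul, stabEmbed_mul hΨ hT hactmul hcdef hE_sq f.supp_stab g.supp_stab] }
  have hφ (a : MonoidAlgebra ℂ H) :
      ∃ f, φ f = kerIncl j (Ψ.symm E) * a * kerIncl j (Ψ.symm E) := by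
    obtain ⟨f, hf₁, hf₂, hf⟩ := exists_stabEmbed_eq hΨ hT hs hE_mul hact_surj hE_act a
    exact ⟨⟨f, fun r hr => hf₁ r (hE_notMem hr), hf₂⟩, hf⟩
  have hφ_one : φ 1 = kerIncl j (Ψ.symm E) := by
    obtain ⟨u, hu⟩ := hφ 1
    have hsq : Ψ.symm E * Ψ.symm E = Ψ.symm E := by
      rw [← map_mul]
      exact congrArg Ψ.symm (funext hE_sq)
    rw [mul_one, ← map_mul, hsq] at hu
    rw [← hu, ← mul_one u, map_mul, hu]
    exact (kerIncl_mul_stabEmbed hΨ hT hE_sq (1 : SumAlg Ghat Q act rep).supp_stab).symm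
  have hφ_corner : IsFullCorner φ :=
    { injective f g h := by
        have hcoef : f.coef = g.coef := by
          funext r q
          by_cases hr : r ∈ Set.range rep
          · exact stabEmbed_injective Ψ E hs h (hE_ne hr) q
          · rw [f.supp_rep r hr, g.supp_rep r hr]
        cases f
        cases g
        congr
      exists_eq a := hφ_one ▸ hφ a
      full := by
        rw [hφ_one]
        refine one_mem_span_corner hΨ hT hact_inj hact_surj fun r => ?_
        obtain ⟨q, hq⟩ := hrep_orbit r
        refine ⟨q, ?_⟩
        rw [hE_mem ⟨r, hq.symm⟩]
        exact hE₀_full (act q r) }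
  exact hφ_corner.moritaEquiv
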